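/- Every finite simple graph G on n ≥ 2 vertices with fewer than 2n-3 edges admits a stable cut, i.e., an independent set X of vertices such that G - X is disconnected. -/

import Mathlib

namespace SimpleGraph

variable {V : Type*} (G : SimpleGraph V)

/-- `A` and `B` are disjoint nonempty subsets of `S` without edges between them, and the rest of
`S` is stable, so that the rest is a stable cut of the subgraph induced on `S`. -/
structure StablySeparates (S A B : Set V) : Prop where
  left_subset : A ⊆ S
  right_subset : B ⊆ S
  disjoint : Disjoint A B
  left_nonempty : A.Nonempty
  right_nonempty : B.Nonempty
  not_adj : ∀ a ∈ A, ∀ b ∈ B, ¬ G.Adj a b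
  stable : ∀ x ∈ S \ (A ∪ B), ∀ y ∈ S \ (A ∪ B), ¬ G.Adj x y

/-- The subgraph induced on `S` has a stable cut which either avoids `v` or is just `{v}`. -/
def HasStableCutAt (S : Set V) (v : V) : Prop :=
  ∃ A B, G.StablySeparates S A B ∧ (v ∈ A ∨ S \ (A ∪ B) = {v})

/-- The graph in which `v` also takes over the neighbours of `w`; on the complement of `w` this is
the contraction of the edge `vw`. -/
def absorb (v w : V) : SimpleGraph V :=
  G ⊔ fromRel fun x y => x = v ∧ G.Adj w y

variable {G}

lemma StablySeparates.symm {S A B : Set V} (h : G.StablySeparates S A B) :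
    G.StablySeparates S B A where
  left_subset := h.right_subset
  right_subset := h.left_subset
  disjoint := h.disjoint.symm
  left_nonempty := h.right_nonempty
  right_nonempty := h.left_nonempty
  not_adj b hb a ha hab := h.not_adj a ha b hb hab.symm
  stable := by simpa only [Set.union_comm B A] using h.stable

lemma StablySeparates.preimage_absorb {S A B : Set V} {v w : V} (hw : w ∈ S)
    (h : (G.absorb v w).StablySeparates (S \ {w}) A B) (hv : v ∈ A) :
    G.StablySeparates S (insert w A) B := by
  obtain ⟨hA, hB, hd, hAn, hBn, hAB, hX⟩ := h
  rw [Set.disjoint_left] at hd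
  refine ⟨?_, ?_, ?_, ?_, hBn, ?_, ?_⟩
  · intro x hx
    rcases hx with rfl | hx
    exacts [hw, (hA hx).1]
  · exact fun x hx => (hB hx).1
  · rw [Set.disjoint_left]
    rintro x (rfl | hx) hxB
    exacts [(hB hxB).2 rfl, hd hx hxB]
  · exact ⟨w, Set.mem_insert _ _⟩
  · rintro a (rfl | ha) b hb hab
    · refine hAB v hv b hb (Or.inr ⟨?_, Or.inl ⟨rfl, hab⟩⟩)
      rintro rfl
      exact hd hv hb
    · exact hAB a ha b hb (Or.inl hab)
  · intro x hx y hy hxy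
    refine hX x ?_ y ?_ (Or.inl hxy) <;> simp_all

/-- A stable cut of one side of the cut `{v, w}`, where `v` and `w` are adjacent, extends. -/
lemma HasStableCutAt.of_side {S A B : Set V} {v w : V} (hAS : A ∪ B ∪ {v, w} = S)
    (hvA : v ∉ A) (hvB : v ∉ B) (hwA : w ∉ A) (hwB : w ∉ B) (hAB : Disjoint A B)
    (hadj : G.Adj v w) (hno : ∀ a ∈ A, ∀ b ∈ B, ¬ G.Adj a b)
    (h : G.HasStableCutAt (A ∪ {v, w}) v) : G.HasStableCutAt S v := by
  subst hAS
  rw [Set.disjoint_left] at hAB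
  have key : ∀ C D, G.StablySeparates (A ∪ {v, w}) C D → v ∉ D → w ∉ D →
      G.StablySeparates (A ∪ B ∪ {v, w}) (C ∪ B) D ∧
        (A ∪ B ∪ {v, w}) \ (C ∪ B ∪ D) = (A ∪ {v, w}) \ (C ∪ D) := by
    intro C D ⟨hC, hD, hd, hCn, hDn, hCD, hX⟩ hv hw
    have hDA : ∀ x ∈ D, x ∈ A := by
      intro x hx
      rcases hD hx with h | rfl | rfl
      exacts [h, absurd hx hv, absurd hx hw]
    have heq : (A ∪ B ∪ {v, w}) \ (C ∪ B ∪ D) = (A ∪ {v, w}) \ (C ∪ D) := by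
      ext x
      simp only [Set.mem_sdiff, Set.mem_union, Set.mem_insert_iff, Set.mem_singleton_iff]
      grind
    rw [Set.disjoint_left] at hd
    refine ⟨⟨?_, ?_, ?_, hCn.mono Set.subset_union_left, hDn, ?_, ?_⟩, heq⟩
    · rintro x (hx | hx)
      · rcases hC hx with h | h
        exacts [Or.inl (Or.inl h), Or.inr h]
      · exact Or.inl (Or.inr hx)
    · exact fun x hx => Or.inl (Or.inl (hDA x hx))
    · rw [Set.disjoint_left]
      rintro x (hx | hx) hxD
      exacts [hd hx hxD, hAB (hDA x hxD) hx]
    · rintro a (ha | ha) b hb hab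
      exacts [hCD a ha b hb hab, hno b (hDA b hb) a ha hab.symm]
    · rwa [heq]
  obtain ⟨C, D, hCD, hv | hX⟩ := h
  · have hvD : v ∉ D := Set.disjoint_left.1 hCD.disjoint hv
    have hwD : w ∉ D := fun hw => hCD.not_adj v hv w hw hadj
    exact ⟨_, _, (key C D hCD hvD hwD).1, Or.inl (Or.inl hv)⟩
  · have hv : v ∉ C ∪ D := fun h => (hX.symm ▸ Set.mem_singleton v :
      v ∈ (A ∪ {v, w}) \ (C ∪ D)).2 h
    by_cases hw : w ∈ D
    · obtain ⟨h₁, h₂⟩ := key D C hCD.symm (fun h => hv (Or.inl h))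
        (fun h => Set.disjoint_left.1 hCD.disjoint h hw)
      exact ⟨_, _, h₁, Or.inr (by rw [h₂, Set.union_comm D C, hX])⟩
    · obtain ⟨h₁, h₂⟩ := key C D hCD (fun h => hv (Or.inr h)) hw
      exact ⟨_, _, h₁, Or.inr (by rw [h₂, hX])⟩

open scoped Classical in
/-- The edges of `G` with both ends in `S`. -/
noncomputable def edgesIn (G : SimpleGraph V) (S : Finset V) : Finset (Sym2 V) :=
  S.sym2.filter (· ∈ G.edgeSet)

lemma mk_mem_edgesIn {S : Finset V} {x y : V} :
    s(x, y) ∈ G.edgesIn S ↔ (x ∈ S ∧ y ∈ S) ∧ G.Adj x y := by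
  simp [edgesIn]

open scoped Classical in
lemma card_edgesIn_absorb_add_two_le {S : Finset V} {v w y : V} (hv : v ∈ S) (hw : w ∈ S)
    (hy : y ∈ S) (hvw : G.Adj v w) (hwy : G.Adj w y) (hvy : G.Adj v y) :
    ((G.absorb v w).edgesIn (S.erase w)).card + 2 ≤ (G.edgesIn S).card := by
  set P := S.filter fun z => G.Adj w z ∧ z ≠ v ∧ ¬ G.Adj v z with hP
  have h₁ : (G.absorb v w).edgesIn (S.erase w) ⊆
      G.edgesIn (S.erase w) ∪ P.image fun z => s(v, z) := by
    intro e
    induction e with | _ a b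
    simp only [Finset.mem_union, mk_mem_edgesIn, Finset.mem_image, absorb, sup_adj, fromRel_adj,
      hP, Finset.mem_filter, Finset.mem_erase]
    rintro ⟨⟨ha, hb⟩, hab⟩
    by_cases h : G.Adj a b
    · exact Or.inl ⟨⟨ha, hb⟩, h⟩
    · right
      rcases hab with hab | ⟨hne, ⟨rfl, hab⟩ | ⟨rfl, hab⟩⟩
      · exact absurd hab h
      · exact ⟨b, ⟨hb.2, hab, hne.symm, h⟩, rfl⟩
      · exact ⟨a, ⟨ha.2, hab, hne, fun h' => h h'.symm⟩, Sym2.eq_swap⟩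
  have h₂ : G.edgesIn (S.erase w) ∪ (insert v (insert y P)).image (fun z => s(w, z)) ⊆
      G.edgesIn S := by
    intro e
    induction e with | _ a b
    simp only [Finset.mem_union, mk_mem_edgesIn, Finset.mem_image, Finset.mem_insert, hP,
      Finset.mem_filter, Finset.mem_erase]
    rintro (h | ⟨z, hz, he⟩)
    · exact ⟨⟨h.1.1.2, h.1.2.2⟩, h.2⟩
    · have : (w ∈ S ∧ z ∈ S) ∧ G.Adj w z := by
        rcases hz with rfl | rfl | hz
        exacts [⟨⟨hw, hv⟩, hvw.symm⟩, ⟨⟨hw, hy⟩, hwy⟩, ⟨⟨hw, hz.1⟩, hz.2.1⟩]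
      rw [← mk_mem_edgesIn] at this ⊢
      rwa [← he]
  have h₃ : Disjoint (G.edgesIn (S.erase w))
      ((insert v (insert y P)).image (fun z => s(w, z))) := by
    rw [Finset.disjoint_right]
    intro e he
    obtain ⟨z, -, rfl⟩ := Finset.mem_image.1 he
    simp [mk_mem_edgesIn]
  have h₄ := Finset.card_le_card h₁
  have h₅ := Finset.card_le_card h₂
  rw [Finset.card_union_of_disjoint h₃, Finset.card_image_of_injective _
    (fun a b h => Sym2.congr_right.1 h), Finset.card_insert_of_notMem,
    Finset.card_insert_of_notMem] at h₅
  · have h₆ := Finset.card_union_le (G.edgesIn (S.erase w)) (P.image fun z => s(v, z))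
    have h₇ : (P.image fun z => s(v, z)).card ≤ P.card := Finset.card_image_le
    omega
  · simp [hP, hvy]
  · simp [hP, hvy.ne]

open scoped Classical in
lemma card_edgesIn_add_card_edgesIn_le {S T U : Finset V} {v w : V} (hT : T ⊆ S) (hU : U ⊆ S)
    (hTU : T ∩ U ⊆ {v, w}) :
    (G.edgesIn T).card + (G.edgesIn U).card ≤ (G.edgesIn S).card + 1 := by
  rw [← Finset.card_union_add_card_inter]
  refine Nat.add_le_add (Finset.card_le_card ?_) ?_
  · intro e
    induction e with | _ a b
    simp only [Finset.mem_union, mk_mem_edgesIn]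
    rintro (h | h)
    exacts [⟨⟨hT h.1.1, hT h.1.2⟩, h.2⟩, ⟨⟨hU h.1.1, hU h.1.2⟩, h.2⟩]
  · refine (Finset.card_le_card (t := {s(v, w)}) ?_).trans_eq (Finset.card_singleton _)
    intro e
    induction e with | _ a b
    simp only [Finset.mem_inter, mk_mem_edgesIn, Finset.mem_singleton]
    rintro ⟨h, h'⟩
    have ha := hTU (Finset.mem_inter.2 ⟨h.1.1, h'.1.1⟩)
    have hb := hTU (Finset.mem_inter.2 ⟨h.1.2, h'.1.2⟩)
    have hne := h.2.ne
    simp only [Finset.mem_insert, Finset.mem_singleton] at ha hb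
    rcases ha with rfl | rfl <;> rcases hb with rfl | rfl <;> simp_all [Sym2.eq_swap]

open scoped Classical in
lemma hasStableCutAt_of_no_triangle {S : Finset V} {v : V} (hv : v ∈ S) (hS : 2 ≤ S.card)
    (hE : (G.edgesIn S).card + 4 ≤ 2 * S.card)
    (hN : ∀ x ∈ S, ∀ y ∈ S, G.Adj v x → G.Adj v y → ¬ G.Adj x y) :
    G.HasStableCutAt S v := by
  by_cases h : ∃ b ∈ S, b ≠ v ∧ ¬ G.Adj v b
  · obtain ⟨b, hb, hbv, hvb⟩ := h
    refine ⟨{v}, {x | x ∈ S ∧ x ≠ v ∧ ¬ G.Adj v x}, ⟨by simpa using hv, fun x hx => hx.1, ?_,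
      ⟨v, rfl⟩, ⟨b, hb, hbv, hvb⟩, ?_, ?_⟩, Or.inl rfl⟩
    · simp
    · rintro a rfl x hx
      exact hx.2.2
    · intro x hx y hy
      simp only [Set.mem_sdiff, Finset.mem_coe, Set.mem_union, Set.mem_singleton_iff,
        Set.mem_ofPred_eq] at hx hy
      exact hN x hx.1 y hy.1 (by tauto) (by tauto)
  · push Not at h
    obtain ⟨a, ha, hav⟩ := Finset.exists_mem_ne (by omega : 1 < S.card) v
    have hpos : 0 < (G.edgesIn S).card :=
      Finset.card_pos.2 ⟨s(v, a), mk_mem_edgesIn.2 ⟨⟨hv, ha⟩, h a ha hav⟩⟩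
    obtain ⟨b, hb, hbe⟩ : ∃ b ∈ S, b ∉ ({v, a} : Finset V) := by
      by_contra! hsub
      have := (Finset.card_le_card hsub).trans Finset.card_le_two
      omega
    simp only [Finset.mem_insert, Finset.mem_singleton, not_or] at hbe
    have hX : (S : Set V) \ ({a} ∪ {x | x ∈ S ∧ x ≠ v ∧ x ≠ a}) = {v} := by
      ext x
      simp only [Set.mem_sdiff, Finset.mem_coe, Set.mem_union, Set.mem_singleton_iff,
        Set.mem_ofPred_eq]
      grind
    refine ⟨{a}, {x | x ∈ S ∧ x ≠ v ∧ x ≠ a}, ⟨by simpa using ha, fun x hx => hx.1, ?_,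
      ⟨a, rfl⟩, ⟨b, hb, hbe⟩, ?_, ?_⟩, Or.inr hX⟩
    · simp
    · rintro x rfl y ⟨hy, hyv, -⟩
      exact hN x ha y hy (h x ha hav) (h y hy hyv)
    · rw [hX]
      rintro x rfl y rfl
      exact G.loopless.irrefl _

open scoped Classical in
theorem hasStableCutAt_of_card_edgesIn_le (G : SimpleGraph V) (S : Finset V) {v : V} (hv : v ∈ S)
    (hS : 2 ≤ S.card) (hE : (G.edgesIn S).card + 4 ≤ 2 * S.card) : G.HasStableCutAt S v := by
  induction hn : S.card using Nat.strong_induction_on generalizing G S with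
  | _ n ih
  subst hn
  by_cases hN : ∀ x ∈ S, ∀ y ∈ S, G.Adj v x → G.Adj v y → ¬ G.Adj x y
  · exact hasStableCutAt_of_no_triangle hv hS hE hN
  push Not at hN
  obtain ⟨w, hw, y, hy, hvw, hvy, hwy⟩ := hN
  have h3 : 3 ≤ S.card := by
    rw [← Finset.card_eq_three.2 ⟨v, w, y, hvw.ne, hvy.ne, hwy.ne, rfl⟩]
    exact Finset.card_le_card (by simp [Finset.insert_subset_iff, *])
  have hcontr := card_edgesIn_absorb_add_two_le hv hw hy hvw hwy hvy
  have hcard := Finset.card_erase_of_mem hw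
  obtain ⟨A, B, hAB, hvA | hX⟩ := ih _ (by omega) (G.absorb v w) (S.erase w)
    (Finset.mem_erase.2 ⟨hvw.ne, hv⟩) (by omega) (by omega) rfl
  · rw [Finset.coe_erase] at hAB
    exact ⟨_, _, hAB.preimage_absorb hw hvA, Or.inl (Or.inr hvA)⟩
  obtain ⟨hAS, hBS, hd, hA, hB, hno, -⟩ := hAB
  lift A to Finset V using (S.erase w).finite_toSet.subset hAS
  lift B to Finset V using (S.erase w).finite_toSet.subset hBS
  have hno' : ∀ a ∈ A, ∀ b ∈ B, ¬ G.Adj a b := fun a ha b hb h => hno a ha b hb (Or.inl h)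
  rw [Finset.disjoint_coe] at hd
  rw [Finset.coe_nonempty] at hA hB
  rw [Finset.coe_subset] at hAS hBS
  have hX' : ∀ x, (x ∈ S ∧ x ≠ w) ∧ x ∉ A ∧ x ∉ B ↔ x = v := by
    intro x
    have := Set.ext_iff.1 hX x
    simp only [Set.mem_sdiff, Finset.mem_coe, Finset.mem_erase, Set.mem_union,
      Set.mem_singleton_iff] at this
    tauto
  have hvAB := ((hX' v).2 rfl).2
  have hwA : w ∉ A := fun h => (Finset.mem_erase.1 (hAS h)).1 rfl
  have hwB : w ∉ B := fun h => (Finset.mem_erase.1 (hBS h)).1 rfl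
  have hSeq : A ∪ B ∪ {v, w} = S := by
    ext x
    have h₁ := hX' x
    have h₂ := @hAS x
    have h₃ := @hBS x
    simp only [Finset.mem_union, Finset.mem_insert, Finset.mem_singleton, Finset.mem_erase]
      at h₂ h₃ ⊢
    grind
  have hpair : ({v, w} : Finset V).card = 2 := Finset.card_pair hvw.ne
  have hdisj : ∀ C : Finset V, v ∉ C → w ∉ C → (C ∪ {v, w}).card = C.card + 2 := by
    intro C hvC hwC
    rw [Finset.card_union_of_disjoint (by simp [hvC, hwC]), hpair]
  have hcA := hdisj A hvAB.1 hwA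
  have hcB := hdisj B hvAB.2 hwB
  have hcS : S.card = A.card + B.card + 2 := by
    rw [← hSeq, hdisj _ (by simp [hvAB]) (by simp [hwA, hwB]), Finset.card_union_of_disjoint hd]
  have hsum : (G.edgesIn (A ∪ {v, w})).card + (G.edgesIn (B ∪ {v, w})).card ≤
      (G.edgesIn S).card + 1 := by
    refine card_edgesIn_add_card_edgesIn_le (v := v) (w := w) ?_ ?_ ?_
    · rw [← hSeq]; grind
    · rw [← hSeq]; grind
    · rw [← Finset.inter_union_distrib_right, Finset.disjoint_iff_inter_eq_empty.1 hd,
        Finset.empty_union]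
  have hA' := hA.card_pos
  have hB' := hB.card_pos
  by_cases hle : (G.edgesIn (A ∪ {v, w})).card + 4 ≤ 2 * (A ∪ {v, w}).card
  · have := ih _ (by omega) G (A ∪ {v, w}) (by simp) (by omega) hle rfl
    refine HasStableCutAt.of_side (A := A) (B := B) (w := w) (by simp [← hSeq]) hvAB.1 hvAB.2
      hwA hwB (Finset.disjoint_coe.2 hd) hvw hno' (by simpa using this)
  · have := ih _ (by omega) G (B ∪ {v, w}) (by simp) (by omega) (by omega) rfl
    refine HasStableCutAt.of_side (A := B) (B := A) (w := w)
      (by rw [← hSeq, Finset.union_comm A B]; simp) hvAB.2 hvAB.1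
      hwB hwA (Finset.disjoint_coe.2 hd.symm) hvw (fun b hb a ha h => hno' a ha b hb h.symm)
      (by simpa using this)

lemma StablySeparates.not_preconnected {A B : Set V} (h : G.StablySeparates Set.univ A B) :
    ¬ (G.induce (Set.univ \ (A ∪ B))ᶜ).Preconnected := by
  obtain ⟨a, ha⟩ := h.left_nonempty
  obtain ⟨b, hb⟩ := h.right_nonempty
  have key : ∀ x y, (G.induce (Set.univ \ (A ∪ B))ᶜ).Walk x y → x.1 ∈ A → y.1 ∈ A := by
    intro x y p
    induction p with
    | nil => exact id
    | @cons x z _ hxz _ ih =>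
      intro hx
      refine ih (by_contra fun hz => ?_)
      have hz' : z.1 ∈ A ∪ B := by_contra fun hz => z.2 ⟨trivial, hz⟩
      exact h.not_adj x hx z (hz'.resolve_left hz) hxz
  intro hc
  obtain ⟨p⟩ := hc ⟨a, by simp [ha]⟩ ⟨b, by simp [hb]⟩
  exact Set.disjoint_left.1 h.disjoint (key _ _ p ha) hb

end SimpleGraph

/-- Chen–Yu: every finite simple graph on `n ≥ 2` vertices with fewer than `2n - 3` edges
admits a stable cut, i.e. an independent set `X` whose removal disconnects the graph. -/
theorem stmt_6 {V : Type*} [Fintype V] (G : SimpleGraph V) [DecidableRel G.Adj]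
    (n : ℕ) (hn : 2 ≤ n) (hcard : Fintype.card V = n)
    (hE : G.edgeFinset.card < 2 * n - 3) :
    ∃ X : Set V, (∀ u ∈ X, ∀ v ∈ X, ¬ G.Adj u v) ∧ ¬ (G.induce Xᶜ).Preconnected := by
  obtain ⟨v⟩ : Nonempty V := Fintype.card_pos_iff.1 (by omega)
  have hedges : G.edgesIn Finset.univ = G.edgeFinset := by
    ext e
    induction e with | _ a b
    simp [SimpleGraph.mk_mem_edgesIn]
  obtain ⟨A, B, hAB, -⟩ := G.hasStableCutAt_of_card_edgesIn_le Finset.univ (Finset.mem_univ v)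
    (by rwa [Finset.card_univ, hcard]) (by rw [hedges, Finset.card_univ, hcard]; omega)
  rw [Finset.coe_univ] at hAB
  exact ⟨_, hAB.stable, hAB.not_preconnected⟩
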